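/- Let G be a measurable group equipped with a measure μ, let Λ be a countable subgroup of G acting on G by left translation, with μ invariant under this action, and let s be a fundamental domain for the action of Λ on G (i.e. a measurable set such that almost every point of G lies in exactly one translate γ • s for γ ∈ Λ). Then the space L²(G, μ) of square-integrable complex-valued functions on G decomposes as the ℓ²-direct sum over γ ∈ Λ of the spaces L²(γ • s, μ); equivalently, the map sending f ∈ L²(G, μ) to the family (γ ↦ (the restriction of the translate of f by γ to s)) is a linear isometric equivalence from L²(G, μ) onto the ℓ²-sum lp (fun (γ : Λ) => L²(s, μ.restrict s)) 2. (This is the identification L²(G) = ℓ²(Λ) ⊗ L²(Λ\G) used in the diagram in the paper, in the form of a fundamental-domain decomposition.) -/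

import Mathlib

open MeasureTheory

section SMulInvariant

variable {Γ α : Type*} [Group Γ] [MulAction Γ α] [MeasurableSpace α] {μ : Measure α}
  [SMulInvariantMeasure Γ α μ]

/-- Under a measure-invariant group action, preimages of measurable sets of finite measure are
null-measurable, even if the action is not assumed to be measurable. -/
theorem nullMeasurableSet_preimage_smul_of_measure_ne_top (γ : Γ) {A : Set α}
    (hA : MeasurableSet A) (hμA : μ A ≠ ⊤) :
    NullMeasurableSet ((fun x => γ • x) ⁻¹' A) μ := by
  set B := toMeasurable μ ((fun x => γ • x) ⁻¹' A)
  have hμB : μ B = μ A := by rw [measure_toMeasurable, measure_preimage_smul]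
  have hμ : μ ((fun x => γ⁻¹ • x) ⁻¹' B) = μ A := by rw [measure_preimage_smul, hμB]
  have hsub : A ⊆ (fun x => γ⁻¹ • x) ⁻¹' B := fun x hx =>
    subset_toMeasurable μ _ (by simpa using hx)
  have hae : A =ᵐ[μ] (fun x => γ⁻¹ • x) ⁻¹' B :=
    ae_eq_of_subset_of_measure_ge hsub hμ.le hA.nullMeasurableSet (hμ ▸ hμA)
  have hpre : (fun x => γ • x) ⁻¹' A =ᵐ[μ] B := by
    filter_upwards [tendsto_smul_ae μ γ hae] with x hx
    have hx' : (γ • x ∈ A) = (γ⁻¹ • γ • x ∈ B) := hx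
    rw [inv_smul_smul] at hx'
    exact hx'
  exact (measurableSet_toMeasurable μ _).nullMeasurableSet.congr hpre.symm

theorem aemeasurable_comp_smul_of_memLp (γ : Γ) {f : α → ℂ} (hfm : Measurable f)
    (hf : MemLp f 2 μ) : AEMeasurable (fun x => f (γ • x)) μ := by
  have key : ∀ B : Set ℂ, MeasurableSet B → (0 : ℂ) ∉ B →
      NullMeasurableSet ((fun x => γ • x) ⁻¹' (f ⁻¹' B)) μ := by
    intro B hB h0
    have hunion : f ⁻¹' B =
        ⋃ n : ℕ, f ⁻¹' B ∩ {x | (1 / ((n : NNReal) + 1)) ≤ ‖f x‖₊} := by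
      rw [← Set.inter_iUnion, eq_comm, Set.inter_eq_left]
      intro x hx
      have hpos : 0 < ‖f x‖ := norm_pos_iff.2 fun h => h0 (h ▸ hx)
      obtain ⟨n, hn⟩ := exists_nat_one_div_lt hpos
      exact Set.mem_iUnion.2 ⟨n, by
        rw [Set.mem_ofPred_eq, ← NNReal.coe_le_coe]; push_cast; exact hn.le⟩
    rw [hunion, Set.preimage_iUnion]
    refine NullMeasurableSet.iUnion fun n =>
      nullMeasurableSet_preimage_smul_of_measure_ne_top γ
        ((hfm hB).inter (measurableSet_le measurable_const hfm.nnnorm)) ?_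
    exact measure_ne_top_of_subset Set.inter_subset_right
      (hf.meas_ge_lt_top two_ne_zero ENNReal.ofNat_ne_top (by positivity)).ne
  refine NullMeasurable.aemeasurable fun B hB => ?_
  by_cases h0 : (0 : ℂ) ∈ B
  · rw [← compl_compl B]
    exact (key Bᶜ hB.compl (by simpa using h0)).compl
  · exact key B hB h0

theorem identDistrib_comp_smul_of_memLp (γ : Γ) {f : α → ℂ} (hfm : Measurable f)
    (hf : MemLp f 2 μ) : ProbabilityTheory.IdentDistrib (fun x => f (γ • x)) f μ μ where
  aemeasurable_fst := aemeasurable_comp_smul_of_memLp γ hfm hf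
  aemeasurable_snd := hfm.aemeasurable
  map_eq := by
    ext B hB
    rw [Measure.map_apply_of_aemeasurable (aemeasurable_comp_smul_of_memLp γ hfm hf) hB,
      Measure.map_apply hfm hB]
    exact measure_preimage_smul μ γ (f ⁻¹' B)

theorem Lp.identDistrib_comp_smul (γ : Γ) (f : Lp ℂ 2 μ) :
    ProbabilityTheory.IdentDistrib (fun x => f (γ • x)) f μ μ :=
  identDistrib_comp_smul_of_memLp γ (Lp.stronglyMeasurable f).measurable (Lp.memLp f)

theorem Lp.memLp_comp_smul (γ : Γ) (f : Lp ℂ 2 μ) : MemLp (fun x => f (γ • x)) 2 μ :=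
  (Lp.identDistrib_comp_smul γ f).memLp_iff.2 (Lp.memLp f)

variable (μ) in
/-- Translation by an element of a group acting on a measure space with invariant measure, as a
linear isometry of `L²`. -/
noncomputable def translateL2 (γ : Γ) : Lp ℂ 2 μ →ₗᵢ[ℂ] Lp ℂ 2 μ where
  toFun f := (Lp.memLp_comp_smul γ f).toLp _
  map_add' f g := by
    rw [← MemLp.toLp_add]
    exact MemLp.toLp_congr _ _ (tendsto_smul_ae μ γ (Lp.coeFn_add f g))
  map_smul' c f := by
    rw [RingHom.id_apply, ← MemLp.toLp_const_smul]
    exact MemLp.toLp_congr _ _ (tendsto_smul_ae μ γ (Lp.coeFn_smul c f))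
  norm_map' f := by
    change ‖(Lp.memLp_comp_smul γ f).toLp _‖ = _
    rw [Lp.norm_toLp, (Lp.identDistrib_comp_smul γ f).eLpNorm_eq, Lp.norm_def]

theorem coeFn_translateL2 (γ : Γ) (f : Lp ℂ 2 μ) :
    translateL2 μ γ f =ᵐ[μ] fun x => f (γ • x) :=
  MemLp.coeFn_toLp (Lp.memLp_comp_smul γ f)

theorem translateL2_translateL2_inv (γ : Γ) (f : Lp ℂ 2 μ) :
    translateL2 μ γ (translateL2 μ γ⁻¹ f) = f := by
  ext1
  filter_upwards [coeFn_translateL2 γ (translateL2 μ γ⁻¹ f),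
    tendsto_smul_ae μ γ (coeFn_translateL2 γ⁻¹ f)] with x hx hx'
  have hx'' : translateL2 μ γ⁻¹ f (γ • x) = f (γ⁻¹ • γ • x) := hx'
  rw [hx, hx'', inv_smul_smul]

theorem inner_translateL2_inv_left (γ : Γ) (f g : Lp ℂ 2 μ) :
    inner ℂ (translateL2 μ γ⁻¹ f) g = inner ℂ f (translateL2 μ γ g) := by
  rw [← (translateL2 μ γ).inner_map_map, translateL2_translateL2_inv]

end SMulInvariant

section ExtendByZero

variable {α : Type*} [MeasurableSpace α] {μ : Measure α} {s : Set α}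

theorem eLpNorm_indicator_eq_eLpNorm_restrict_of_nullMeasurableSet
    (hs : NullMeasurableSet s μ) (f : α → ℂ) :
    eLpNorm (s.indicator f) 2 μ = eLpNorm f 2 (μ.restrict s) := by
  obtain ⟨t, -, ht, hts⟩ := hs.exists_measurable_subset_ae_eq
  rw [← Measure.restrict_congr_set hts, ← eLpNorm_indicator_eq_eLpNorm_restrict ht]
  exact eLpNorm_congr_ae (indicator_ae_eq_of_ae_eq_set hts.symm)

theorem MemLp.indicator_of_restrict (hs : NullMeasurableSet s μ) {f : α → ℂ}
    (hf : MemLp f 2 (μ.restrict s)) : MemLp (s.indicator f) 2 μ :=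
  ⟨(aestronglyMeasurable_indicator_iff₀ hs).2 hf.1, by
    rw [eLpNorm_indicator_eq_eLpNorm_restrict_of_nullMeasurableSet hs]; exact hf.2⟩

theorem indicator_ae_eq_of_ae_eq_restrict (hs : NullMeasurableSet s μ) {f g : α → ℂ}
    (h : f =ᵐ[μ.restrict s] g) : s.indicator f =ᵐ[μ] s.indicator g := by
  filter_upwards [(ae_restrict_iff'₀ hs).1 h] with x hx
  by_cases hxs : x ∈ s <;> simp [hxs, hx]

/-- Extension by zero from `L²(s)` to `L²`, as a linear isometry. -/
noncomputable def extendByZeroL2 (hs : NullMeasurableSet s μ) :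
    Lp ℂ 2 (μ.restrict s) →ₗᵢ[ℂ] Lp ℂ 2 μ where
  toFun g := (MemLp.indicator_of_restrict hs (Lp.memLp g)).toLp _
  map_add' f g := by
    rw [← MemLp.toLp_add]
    refine MemLp.toLp_congr _ _ ?_
    rw [← Set.indicator_add']
    exact indicator_ae_eq_of_ae_eq_restrict hs (Lp.coeFn_add f g)
  map_smul' c f := by
    rw [RingHom.id_apply, ← MemLp.toLp_const_smul]
    refine MemLp.toLp_congr _ _ ?_
    exact (indicator_ae_eq_of_ae_eq_restrict hs (Lp.coeFn_smul c f)).trans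
      (.of_eq (Set.indicator_const_smul s c f))
  norm_map' f := by
    change ‖(MemLp.indicator_of_restrict hs (Lp.memLp f)).toLp _‖ = _
    rw [Lp.norm_toLp, eLpNorm_indicator_eq_eLpNorm_restrict_of_nullMeasurableSet hs, Lp.norm_def]

theorem coeFn_extendByZeroL2 (hs : NullMeasurableSet s μ) (g : Lp ℂ 2 (μ.restrict s)) :
    extendByZeroL2 hs g =ᵐ[μ] s.indicator g :=
  MemLp.coeFn_toLp (MemLp.indicator_of_restrict hs (Lp.memLp g))

theorem inner_extendByZeroL2_left (hs : NullMeasurableSet s μ) (g : Lp ℂ 2 (μ.restrict s))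
    (f : Lp ℂ 2 μ) :
    inner ℂ (extendByZeroL2 hs g) f = inner ℂ g (LpToLpRestrictCLM α ℂ ℂ μ 2 s f) := by
  rw [L2.inner_def, L2.inner_def]
  calc ∫ x, inner ℂ (extendByZeroL2 hs g x) (f x) ∂μ
      = ∫ x, s.indicator (fun x => inner ℂ (g x) (f x)) x ∂μ := by
        refine integral_congr_ae ?_
        filter_upwards [coeFn_extendByZeroL2 hs g] with x hx
        by_cases hxs : x ∈ s <;> simp [hx, hxs]
    _ = ∫ x in s, inner ℂ (g x) (f x) ∂μ := integral_indicator₀ hs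
    _ = ∫ x in s, inner ℂ (g x) (LpToLpRestrictCLM α ℂ ℂ μ 2 s f x) ∂μ := by
        refine integral_congr_ae ?_
        filter_upwards [LpToLpRestrictCLM_coeFn (p := 2) ℂ s f] with x hx
        rw [hx]

end ExtendByZero

namespace MeasureTheory.IsFundamentalDomain

variable {Γ α : Type*} [Group Γ] [MulAction Γ α] [MeasurableSpace α] {μ : Measure α}
  [SMulInvariantMeasure Γ α μ] {s : Set α}

/-- The isometric embedding of `L²(s)` into `L²` as functions supported on `γ • s`. -/
noncomputable def embedL2 (hs : IsFundamentalDomain Γ s μ) (γ : Γ) :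
    Lp ℂ 2 (μ.restrict s) →ₗᵢ[ℂ] Lp ℂ 2 μ :=
  (translateL2 μ γ⁻¹).comp (extendByZeroL2 hs.nullMeasurableSet)

theorem coeFn_embedL2 (hs : IsFundamentalDomain Γ s μ) (γ : Γ) (g : Lp ℂ 2 (μ.restrict s)) :
    hs.embedL2 γ g =ᵐ[μ] fun x => s.indicator g (γ⁻¹ • x) :=
  (coeFn_translateL2 γ⁻¹ _).trans
    (tendsto_smul_ae μ γ⁻¹ (coeFn_extendByZeroL2 hs.nullMeasurableSet g))

theorem inner_embedL2_left (hs : IsFundamentalDomain Γ s μ) (γ : Γ)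
    (g : Lp ℂ 2 (μ.restrict s)) (f : Lp ℂ 2 μ) :
    inner ℂ (hs.embedL2 γ g) f =
      inner ℂ g (LpToLpRestrictCLM α ℂ ℂ μ 2 s (translateL2 μ γ f)) := by
  rw [← inner_extendByZeroL2_left hs.nullMeasurableSet, ← inner_translateL2_inv_left]
  rfl

theorem coeFn_restrict_translateL2 (γ : Γ) (f : Lp ℂ 2 μ) :
    LpToLpRestrictCLM α ℂ ℂ μ 2 s (translateL2 μ γ f) =ᵐ[μ.restrict s] fun x => f (γ • x) :=
  (LpToLpRestrictCLM_coeFn ℂ s _).trans (ae_restrict_of_ae (coeFn_translateL2 γ f))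

open scoped Pointwise in
theorem orthogonalFamily_embedL2 (hs : IsFundamentalDomain Γ s μ) :
    OrthogonalFamily ℂ (fun _ : Γ => Lp ℂ 2 (μ.restrict s)) hs.embedL2 := by
  intro γ δ hγδ g h
  rw [L2.inner_def]
  refine integral_eq_zero_of_ae ?_
  have hdisj : ∀ᵐ x ∂μ, x ∉ γ • s ∩ δ • s := measure_eq_zero_iff_ae_notMem.1 (hs.aedisjoint hγδ)
  filter_upwards [hs.coeFn_embedL2 γ g, hs.coeFn_embedL2 δ h, hdisj] with x hg hh hx
  rw [hg, hh]
  by_cases hγ : γ⁻¹ • x ∈ s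
  · have hδ : δ⁻¹ • x ∉ s := fun hδ =>
      hx ⟨Set.mem_smul_set_iff_inv_smul_mem.2 hγ, Set.mem_smul_set_iff_inv_smul_mem.2 hδ⟩
    simp [hδ]
  · simp [hγ]

theorem eq_zero_of_forall_comp_smul_ae_eq_zero [Countable Γ] (hs : IsFundamentalDomain Γ s μ)
    {f : α → ℂ} (hf : ∀ γ : Γ, ∀ᵐ x ∂μ.restrict s, f (γ • x) = 0) : f =ᵐ[μ] 0 := by
  have hall : ∀ᵐ x ∂μ, ∀ γ : Γ, γ • x ∈ s → f (γ⁻¹ • γ • x) = 0 :=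
    ae_all_iff.2 fun γ =>
      tendsto_smul_ae μ γ ((ae_restrict_iff'₀ hs.nullMeasurableSet).1 (hf γ⁻¹))
  filter_upwards [hall, hs.ae_covers] with x hx ⟨γ, hγ⟩
  simpa using hx γ hγ

theorem isHilbertSum_embedL2 [Countable Γ] (hs : IsFundamentalDomain Γ s μ) :
    IsHilbertSum ℂ (fun _ : Γ => Lp ℂ 2 (μ.restrict s)) hs.embedL2 := by
  refine IsHilbertSum.mk hs.orthogonalFamily_embedL2 (top_le_iff.2 ?_)
  rw [Submodule.topologicalClosure_eq_top_iff, Submodule.eq_bot_iff]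
  intro f hf
  rw [Lp.eq_zero_iff_ae_eq_zero]
  refine hs.eq_zero_of_forall_comp_smul_ae_eq_zero fun γ => ?_
  have hzero : LpToLpRestrictCLM α ℂ ℂ μ 2 s (translateL2 μ γ f) = 0 := by
    refine ext_inner_left ℂ fun g => ?_
    rw [← hs.inner_embedL2_left, inner_zero_right]
    exact (Submodule.mem_orthogonal _ f).1 hf _
      (Submodule.mem_iSup_of_mem γ (LinearMap.mem_range_self _ g))
  have hae := coeFn_restrict_translateL2 (s := s) γ f
  rw [hzero] at hae
  filter_upwards [hae, Lp.coeFn_zero ℂ 2 (μ.restrict s)] with x hx hx0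
  rw [← hx, hx0, Pi.zero_apply]

theorem linearIsometryEquiv_embedL2_apply [Countable Γ] (hs : IsFundamentalDomain Γ s μ)
    (f : Lp ℂ 2 μ) (γ : Γ) :
    hs.isHilbertSum_embedL2.linearIsometryEquiv f γ =
      LpToLpRestrictCLM α ℂ ℂ μ 2 s (translateL2 μ γ f) := by
  classical
  set e := hs.isHilbertSum_embedL2.linearIsometryEquiv
  refine ext_inner_left ℂ fun g => ?_
  calc inner ℂ g (e f γ) = inner ℂ (lp.single 2 γ g) (e f) :=
        (lp.inner_single_left (𝕜 := ℂ) γ g (e f)).symm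
    _ = inner ℂ (e.symm (lp.single 2 γ g)) f := by
        rw [← e.symm.inner_map_map, e.symm_apply_apply]
    _ = inner ℂ (hs.embedL2 γ g) f := by
        rw [hs.isHilbertSum_embedL2.linearIsometryEquiv_symm_apply_single]
    _ = _ := hs.inner_embedL2_left γ g f

end MeasureTheory.IsFundamentalDomain

/-- If `Λ` is a countable subgroup of a measurable group `G` acting by left translation,
`μ` is invariant under this action, and `s` is a fundamental domain for the action, then
`L²(G, μ)` decomposes as the `ℓ²`-direct sum over `γ ∈ Λ` of copies of `L²(s, μ)`:
the map sending `f` to the family `γ ↦ (restriction to `s` of the translate of `f` by `γ`)`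
is a linear isometric equivalence `L²(G, μ) ≃ lp (fun γ : Λ => L²(s, μ.restrict s)) 2`.
(The identification `L²(G) = ℓ²(Λ) ⊗ L²(Λ\G)`.) -/
theorem l2_decomposition_of_fundamentalDomain
    (G : Type*) [Group G] [MeasurableSpace G] (μ : Measure G)
    (Λ : Subgroup G) [Countable Λ]
    [SMulInvariantMeasure Λ G μ]
    (s : Set G) (hs : IsFundamentalDomain Λ s μ) :
    ∃ e : Lp ℂ 2 μ ≃ₗᵢ[ℂ] lp (fun _ : Λ => Lp ℂ 2 (μ.restrict s)) 2,
      ∀ (f : Lp ℂ 2 μ) (γ : Λ),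
        ∀ᵐ x ∂(μ.restrict s), (e f γ : G → ℂ) x = (f : G → ℂ) (γ • x) := by
  refine ⟨hs.isHilbertSum_embedL2.linearIsometryEquiv, fun f γ => ?_⟩
  rw [hs.linearIsometryEquiv_embedL2_apply]
  exact IsFundamentalDomain.coeFn_restrict_translateL2 γ f
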